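/- Suppose E is a uniform eidostate that is the disjoint union of uniform eidostates E₁ and E₂. Then 𝕊(E) = log₂( 2^{𝕊(E₁)} + 2^{𝕊(E₂)} ). -/

import Mathlib

structure EidoSys where
  State : Type
  [decEq : DecidableEq State]
  Eido : Set (Finset State)
  pair : State → State → State
  Sim : Finset State → Finset State → Prop
  Arrow : Finset State → Finset State → Prop
  pair_inj : ∀ a b a' b', pair a b = pair a' b' → a = a' ∧ b = b'
  eido_nonempty : ∀ A ∈ Eido, A.Nonempty
  singleton_mem : ∀ a : State, ({a} : Finset State) ∈ Eido
  comb_mem : ∀ A B : Finset State, Finset.image₂ pair A B ∈ Eido ↔ A ∈ Eido ∧ B ∈ Eido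
  subset_mem : ∀ A B : Finset State, A ∈ Eido → B ⊆ A → B.Nonempty → B ∈ Eido
  sim_refl : ∀ A : Finset State, Sim A A
  sim_symm : ∀ A B : Finset State, Sim A B → Sim B A
  sim_trans : ∀ A B C : Finset State, Sim A B → Sim B C → Sim A C
  sim_comm : ∀ A B : Finset State, Sim (Finset.image₂ pair A B) (Finset.image₂ pair B A)
  sim_assoc : ∀ A B C : Finset State,
    Sim (Finset.image₂ pair (Finset.image₂ pair A B) C) (Finset.image₂ pair A (Finset.image₂ pair B C))
  sim_congr : ∀ A B C : Finset State, Sim A B → Sim (Finset.image₂ pair A C) (Finset.image₂ pair B C)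
  arrow_of_sim : ∀ A B : Finset State, A ∈ Eido → B ∈ Eido → Sim A B → Arrow A B
  arrow_trans : ∀ A B C : Finset State, Arrow A B → Arrow B C → Arrow A C
  arrow_comb : ∀ A B C : Finset State, Arrow A B → Arrow (Finset.image₂ pair A C) (Finset.image₂ pair B C)
  arrow_cancel : ∀ (A B : Finset State) (s : State),
    Arrow (Finset.image₂ pair A {s}) (Finset.image₂ pair B {s}) → Arrow A B
  arrow_nsubset : ∀ A B : Finset State, A ∈ Eido → B ∈ Eido → B ⊂ A → ¬ Arrow A B
  arrow_subset_single : ∀ (A A' : Finset State) (b : State),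
    A ∈ Eido → A' ⊆ A → A'.Nonempty → Arrow A {b} → Arrow A' {b}
  arrow_union : ∀ A₁ A₂ B₁ B₂ : Finset State,
    A₁ ∈ Eido → A₂ ∈ Eido → B₁ ∈ Eido → B₂ ∈ Eido →
    Disjoint A₁ A₂ → Disjoint B₁ B₂ →
    (∀ a ∈ A₁ ∪ A₂, ∀ b ∈ A₁ ∪ A₂, Arrow {a} {b} ∨ Arrow {b} {a}) →
    (∀ a ∈ B₁ ∪ B₂, ∀ b ∈ B₁ ∪ B₂, Arrow {a} {b} ∨ Arrow {b} {a}) →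
    Arrow A₁ B₁ → Arrow A₂ B₂ → Arrow (A₁ ∪ A₂) (B₁ ∪ B₂)

attribute [instance] EidoSys.decEq

namespace EidoSys

variable (S : EidoSys)

/-- Combination of eidostates: the Cartesian product, realized via the pairing map. -/
def comb (A B : Finset S.State) : Finset S.State := Finset.image₂ S.pair A B

/-- The process (A,B) is possible: A ⇌ B. -/
def Pos (A B : Finset S.State) : Prop := S.Arrow A B ∨ S.Arrow B A

/-- A ↔ B. -/
def Rev (A B : Finset S.State) : Prop := S.Arrow A B ∧ S.Arrow B A

/-- Uniform eidostate. -/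
def Uniform (A : Finset S.State) : Prop := A ∈ S.Eido ∧ ∀ a ∈ A, ∀ b ∈ A, S.Pos {a} {b}

/-- Record state: a ↔ a + r for some state a. -/
def IsRecord (r : S.State) : Prop := ∃ a : S.State, S.Rev {a} (S.comb {a} {r})

/-- Information state: an eidostate all of whose elements are record states. -/
def IsInfo (I : Finset S.State) : Prop := I ∈ S.Eido ∧ ∀ r ∈ I, S.IsRecord r

/-- Bit state: an information state with exactly two elements. -/
def IsBit (I : Finset S.State) : Prop := S.IsInfo I ∧ I.card = 2

/-- Information axiom: there exist a bit state and a possible bit process. -/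
def InfoAxiom : Prop := ∃ (r : S.State) (I : Finset S.State), S.IsRecord r ∧ S.IsBit I ∧ S.Pos {r} I

/-- Demon axiom. -/
def DemonAxiom : Prop := ∀ a b : S.State, ∀ J : Finset S.State, S.IsInfo J →
    S.Arrow {a} (S.comb {b} J) →
    (∃ I : Finset S.State, S.IsInfo I ∧ S.Arrow {b} (S.comb {a} I)) ∧
    (∀ I : Finset S.State, S.IsInfo I → S.Arrow {a} (S.comb {b} I) ∨ S.Arrow (S.comb {b} I) {a})

/-- `copies A n` is the combination of `n+1` copies of `A` (so `copies A 0 = A`). -/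
def copies (A : Finset S.State) : ℕ → Finset S.State
  | 0 => A
  | n + 1 => S.comb A (copies A n)

/-- Stability axiom: if nA → nB + J for arbitrarily large n, then A → B. -/
def StabilityAxiom : Prop := ∀ A B J : Finset S.State, A ∈ S.Eido → B ∈ S.Eido → S.IsInfo J →
    (∀ N : ℕ, ∃ n ≥ N, S.Arrow (S.copies A n) (S.comb (S.copies B n) J)) → S.Arrow A B

/-- State-equivalence axiom. -/
def StateEquivAxiom : Prop := ∀ E : Finset S.State, S.Uniform E →
    ∃ e x y : S.State, S.Arrow {x} {y} ∧ S.Rev (S.comb E {x}) (S.comb {e} {y})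

/-- `addCopies A B k` is A + k·B (k copies of B appended to A). -/
def addCopies (A B : Finset S.State) : ℕ → Finset S.State
  | 0 => A
  | k + 1 => S.comb (addCopies A B k) B

/-- A designated set of mechanical states. -/
def MechSet (M : Set S.State) : Prop :=
  (∀ l ∈ M, ∀ m ∈ M, S.pair l m ∈ M) ∧
  (∀ l ∈ M, ∀ m ∈ M, S.Arrow {l} {m} → S.Arrow {m} {l})

/-- Component of content on uniform eidostates. -/
def IsCoCU (Q : Finset S.State → ℝ) : Prop :=
  (∀ E F : Finset S.State, S.Uniform E → S.Uniform F → Q (S.comb E F) = Q E + Q F) ∧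
  (∀ E F : Finset S.State, S.Uniform E → S.Uniform F → S.Pos E F → Q E = Q F)

/-- Entropy function on the uniform eidostates (relative to mechanical states M). -/
def IsEntropyU (M : Set S.State) (Ent : Finset S.State → ℝ) : Prop :=
  (∀ E F : Finset S.State, S.Uniform E → S.Uniform F → Ent (S.comb E F) = Ent E + Ent F) ∧
  (∀ E F : Finset S.State, S.Uniform E → S.Uniform F → S.Pos E F → (S.Arrow E F ↔ Ent E ≤ Ent F)) ∧
  (∀ m ∈ M, Ent {m} = 0) ∧
  (∀ I : Finset S.State, S.IsInfo I → Ent I = Real.logb 2 (I.card))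

end EidoSys

namespace EidoSys

variable {S : EidoSys}

/-- Two eidostates have the same value for every component of content. -/
def SameContent (S : EidoSys) (E F : Finset S.State) : Prop :=
  ∀ Q : Finset S.State → ℝ, S.IsCoCU Q → Q E = Q F

/-- Uniform eidostates with the same content are related by `Pos`. -/
def ContentComplete (S : EidoSys) : Prop :=
  ∀ E F : Finset S.State, S.Uniform E → S.Uniform F → S.SameContent E F → S.Pos E F

theorem arrow_refl {A : Finset S.State} (hA : A ∈ S.Eido) : S.Arrow A A :=
  S.arrow_of_sim A A hA hA (S.sim_refl A)

theorem uniform_singleton (a : S.State) : S.Uniform {a} := by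
  refine ⟨S.singleton_mem a, fun x hx y hy => ?_⟩
  rw [Finset.mem_singleton] at hx hy
  subst hx hy
  exact Or.inl (arrow_refl (S.singleton_mem _))

theorem comb_singleton (a b : S.State) : S.comb {a} {b} = {S.pair a b} :=
  Finset.image₂_singleton

theorem pair_injective2 : Function.Injective2 S.pair :=
  fun _ _ _ _ h => S.pair_inj _ _ _ _ h

theorem uniform_comb (hc : S.ContentComplete) {E F : Finset S.State} (hE : S.Uniform E)
    (hF : S.Uniform F) : S.Uniform (S.comb E F) := by
  refine ⟨(S.comb_mem E F).2 ⟨hE.1, hF.1⟩, fun x hx y hy => ?_⟩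
  obtain ⟨a, ha, b, hb, rfl⟩ := Finset.mem_image₂.1 hx
  obtain ⟨a', ha', b', hb', rfl⟩ := Finset.mem_image₂.1 hy
  refine hc _ _ (uniform_singleton _) (uniform_singleton _) fun Q hQ => ?_
  rw [← comb_singleton, ← comb_singleton, hQ.1 _ _ (uniform_singleton _) (uniform_singleton _),
    hQ.1 _ _ (uniform_singleton _) (uniform_singleton _),
    hQ.2 _ _ (uniform_singleton _) (uniform_singleton _) (hE.2 a ha a' ha'),
    hQ.2 _ _ (uniform_singleton _) (uniform_singleton _) (hF.2 b hb b' hb')]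

/-- A uniform eidostate has the same content as each of its elements. -/
theorem sameContent_singleton (hc : S.ContentComplete) (hse : S.StateEquivAxiom)
    {E : Finset S.State} (hE : S.Uniform E) {a : S.State} (ha : a ∈ E) :
    S.SameContent E {a} := by
  intro Q hQ
  obtain ⟨e, x, y, hxy, hr⟩ := hse E hE
  have hEx := uniform_comb hc hE (uniform_singleton x)
  have hey := uniform_comb hc (uniform_singleton e) (uniform_singleton y)
  have hax := uniform_comb hc (uniform_singleton a) (uniform_singleton x)
  have h₁ := hQ.2 _ _ hEx hey (Or.inl hr.1)
  have hsub : S.comb {a} {x} ⊆ S.comb E {x} :=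
    Finset.image₂_subset_right (Finset.singleton_subset_iff.2 ha)
  have harrow : S.Arrow (S.comb {a} {x}) (S.comb {e} {y}) := by
    have h := hr.1
    rw [comb_singleton e y] at h ⊢
    exact S.arrow_subset_single _ _ _ hEx.1 hsub (S.eido_nonempty _ hax.1) h
  have h₂ := hQ.2 _ _ hax hey (Or.inl harrow)
  rw [hQ.1 _ _ hE (uniform_singleton x)] at h₁
  rw [hQ.1 _ _ (uniform_singleton a) (uniform_singleton x)] at h₂
  linarith

theorem IsRecord.content_eq_zero (hc : S.ContentComplete) {r : S.State} (hr : S.IsRecord r)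
    {Q : Finset S.State → ℝ} (hQ : S.IsCoCU Q) : Q {r} = 0 := by
  obtain ⟨a, ha⟩ := hr
  have h := hQ.2 _ _ (uniform_singleton a)
    (uniform_comb hc (uniform_singleton a) (uniform_singleton r)) (Or.inl ha.1)
  rw [hQ.1 _ _ (uniform_singleton a) (uniform_singleton r)] at h
  linarith

theorem IsInfo.uniform (hc : S.ContentComplete) {I : Finset S.State} (hI : S.IsInfo I) :
    S.Uniform I :=
  ⟨hI.1, fun a ha b hb => hc _ _ (uniform_singleton a) (uniform_singleton b) fun _ hQ =>
    ((hI.2 a ha).content_eq_zero hc hQ).trans ((hI.2 b hb).content_eq_zero hc hQ).symm⟩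

theorem IsInfo.content_eq_zero (hc : S.ContentComplete) (hse : S.StateEquivAxiom)
    {I : Finset S.State} (hI : S.IsInfo I) {Q : Finset S.State → ℝ} (hQ : S.IsCoCU Q) :
    Q I = 0 := by
  obtain ⟨r, hr⟩ := S.eido_nonempty I hI.1
  rw [sameContent_singleton hc hse (hI.uniform hc) hr Q hQ]
  exact (hI.2 r hr).content_eq_zero hc hQ

theorem IsInfo.subset {I J : Finset S.State} (hI : S.IsInfo I) (hJI : J ⊆ I)
    (hJ : J.Nonempty) : S.IsInfo J :=
  ⟨S.subset_mem I J hI.1 hJI hJ, fun r hr => hI.2 r (hJI hr)⟩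

/-- Combination is associative and commutative up to similarity, in the form
`(A + B) + (C + D) ∼ (A + C) + (B + D)`. -/
theorem sim_comb_comb_comb_comm (A B C D : Finset S.State) :
    S.Sim (S.comb (S.comb A B) (S.comb C D)) (S.comb (S.comb A C) (S.comb B D)) := by
  have congr_right : ∀ {X Y : Finset S.State} (Z : Finset S.State), S.Sim X Y →
      S.Sim (S.comb Z X) (S.comb Z Y) := fun Z h =>
    S.sim_trans _ _ _ (S.sim_comm _ _) (S.sim_trans _ _ _ (S.sim_congr _ _ Z h) (S.sim_comm _ _))
  have h : S.Sim (S.comb B (S.comb C D)) (S.comb C (S.comb B D)) :=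
    S.sim_trans _ _ _ (S.sim_symm _ _ (S.sim_assoc B C D))
      (S.sim_trans _ _ _ (S.sim_congr _ _ D (S.sim_comm B C)) (S.sim_assoc C B D))
  exact S.sim_trans _ _ _ (S.sim_assoc A B _)
    (S.sim_trans _ _ _ (congr_right A h) (S.sim_symm _ _ (S.sim_assoc A C _)))

theorem arrow_comb_comb {A B C D : Finset S.State} (hB : B ∈ S.Eido) (hC : C ∈ S.Eido)
    (hD : D ∈ S.Eido) (hAB : S.Arrow A B) (hCD : S.Arrow C D) :
    S.Arrow (S.comb A C) (S.comb B D) := by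
  refine S.arrow_trans _ _ _ (S.arrow_comb A B C hAB) ?_
  refine S.arrow_trans _ _ _ (S.arrow_of_sim _ _ ((S.comb_mem B C).2 ⟨hB, hC⟩)
    ((S.comb_mem C B).2 ⟨hC, hB⟩) (S.sim_comm B C)) ?_
  exact S.arrow_trans _ _ _ (S.arrow_comb C D B hCD) (S.arrow_of_sim _ _
    ((S.comb_mem D B).2 ⟨hD, hB⟩) ((S.comb_mem B D).2 ⟨hB, hD⟩) (S.sim_comm D B))

theorem IsRecord.pair {r s : S.State} (hr : S.IsRecord r) (hs : S.IsRecord s) :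
    S.IsRecord (S.pair r s) := by
  obtain ⟨a, ha, ha'⟩ := hr
  obtain ⟨b, hb, hb'⟩ := hs
  have mem := S.singleton_mem
  have mem₂ : ∀ x y : S.State, S.comb {x} {y} ∈ S.Eido := fun x y =>
    (S.comb_mem _ _).2 ⟨mem x, mem y⟩
  have mem₄ : ∀ x y z w : S.State, S.comb (S.comb {x} {y}) (S.comb {z} {w}) ∈ S.Eido :=
    fun x y z w => (S.comb_mem _ _).2 ⟨mem₂ x y, mem₂ z w⟩
  refine ⟨S.pair a b, ?_, ?_⟩ <;> rw [← comb_singleton a b, ← comb_singleton r s]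
  · exact S.arrow_trans _ _ _ (arrow_comb_comb (mem₂ a r) (mem b) (mem₂ b s) ha hb)
      (S.arrow_of_sim _ _ (mem₄ _ _ _ _) (mem₄ _ _ _ _) (sim_comb_comb_comb_comm _ _ _ _))
  · exact S.arrow_trans _ _ _
      (S.arrow_of_sim _ _ (mem₄ _ _ _ _) (mem₄ _ _ _ _) (sim_comb_comb_comb_comm _ _ _ _))
      (arrow_comb_comb (mem a) (mem₂ b s) (mem b) ha' hb')

theorem IsInfo.comb {I J : Finset S.State} (hI : S.IsInfo I) (hJ : S.IsInfo J) :
    S.IsInfo (S.comb I J) := by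
  refine ⟨(S.comb_mem I J).2 ⟨hI.1, hJ.1⟩, fun x hx => ?_⟩
  obtain ⟨a, ha, b, hb, rfl⟩ := Finset.mem_image₂.1 hx
  exact (hI.2 a ha).pair (hJ.2 b hb)

/-- The information axiom provides information states of every positive size. -/
theorem exists_isInfo_card_eq (hinfo : S.InfoAxiom) {k : ℕ} (hk : 0 < k) :
    ∃ I : Finset S.State, S.IsInfo I ∧ I.card = k := by
  obtain ⟨r, B, hr, ⟨hB, hBcard⟩, -⟩ := hinfo
  have hpow : ∀ m : ℕ, ∃ I : Finset S.State, S.IsInfo I ∧ I.card = 2 ^ m := by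
    intro m
    induction m with
    | zero =>
      exact ⟨{r}, ⟨S.singleton_mem r, fun s hs => Finset.mem_singleton.1 hs ▸ hr⟩, by simp⟩
    | succ m ih =>
      obtain ⟨I, hI, hcard⟩ := ih
      refine ⟨S.comb B I, hB.comb hI, ?_⟩
      rw [EidoSys.comb, Finset.card_image₂ pair_injective2, hBcard, hcard, pow_succ']
  obtain ⟨I, hI, hcard⟩ := hpow k
  obtain ⟨J, hJI, hJ⟩ := Finset.exists_subset_card_eq (hcard ▸ k.lt_two_pow_self.le : k ≤ I.card)
  exact ⟨J, hI.subset hJI (Finset.card_pos.1 (hJ ▸ hk)), hJ⟩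

theorem disjoint_comb_left {A B : Finset S.State} (h : Disjoint A B) (C D : Finset S.State) :
    Disjoint (S.comb A C) (S.comb B D) := by
  refine Finset.disjoint_left.2 fun x hx hy => ?_
  obtain ⟨a, ha, c, -, rfl⟩ := Finset.mem_image₂.1 hx
  obtain ⟨b, hb, d, -, h'⟩ := Finset.mem_image₂.1 hy
  exact Finset.disjoint_left.1 h ha ((S.pair_inj _ _ _ _ h').1 ▸ hb)

theorem disjoint_comb_right {C D : Finset S.State} (h : Disjoint C D) (A B : Finset S.State) :
    Disjoint (S.comb A C) (S.comb B D) := by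
  refine Finset.disjoint_left.2 fun x hx hy => ?_
  obtain ⟨a, -, c, hc, rfl⟩ := Finset.mem_image₂.1 hx
  obtain ⟨b, -, d, hd, h'⟩ := Finset.mem_image₂.1 hy
  exact Finset.disjoint_left.1 h hc ((S.pair_inj _ _ _ _ h').2 ▸ hd)

theorem comb_union_left (A B C : Finset S.State) :
    S.comb (A ∪ B) C = S.comb A C ∪ S.comb B C :=
  Finset.image₂_union_left

theorem comb_union_right (A B C : Finset S.State) :
    S.comb A (B ∪ C) = S.comb A B ∪ S.comb A C :=
  Finset.image₂_union_right

section Entropy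

variable {M : Set S.State} {Ent : Finset S.State → ℝ}

theorem pos_comb_info (hc : S.ContentComplete) (hse : S.StateEquivAxiom)
    {E F I J : Finset S.State} (hE : S.Uniform E) (hF : S.Uniform F) (hEF : S.SameContent E F)
    (hI : S.IsInfo I) (hJ : S.IsInfo J) : S.Pos (S.comb E I) (S.comb F J) := by
  refine hc _ _ (uniform_comb hc hE (hI.uniform hc)) (uniform_comb hc hF (hJ.uniform hc))
    fun Q hQ => ?_
  rw [hQ.1 _ _ hE (hI.uniform hc), hQ.1 _ _ hF (hJ.uniform hc), hEF Q hQ,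
    hI.content_eq_zero hc hse hQ, hJ.content_eq_zero hc hse hQ]

/-- For eidostates with the same content, appending information states of suitable sizes makes
an arrow possible exactly when the sizes compensate the difference in entropy. -/
theorem arrow_comb_info_iff (hc : S.ContentComplete) (hse : S.StateEquivAxiom)
    (hEnt : S.IsEntropyU M Ent) {E F I J : Finset S.State} (hE : S.Uniform E)
    (hF : S.Uniform F) (hEF : S.SameContent E F) (hI : S.IsInfo I) (hJ : S.IsInfo J) :
    S.Arrow (S.comb E I) (S.comb F J) ↔
      (2 : ℝ) ^ Ent E * I.card ≤ (2 : ℝ) ^ Ent F * J.card := by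
  have hIpos : (0 : ℝ) < I.card := Nat.cast_pos.2 (Finset.card_pos.2 (S.eido_nonempty I hI.1))
  have hJpos : (0 : ℝ) < J.card := Nat.cast_pos.2 (Finset.card_pos.2 (S.eido_nonempty J hJ.1))
  have hpow : ∀ {x n : ℝ}, 0 < n → (2 : ℝ) ^ (x + Real.logb 2 n) = 2 ^ x * n := fun hn => by
    rw [Real.rpow_add two_pos, Real.rpow_logb two_pos (by norm_num) hn]
  rw [hEnt.2.1 _ _ (uniform_comb hc hE (hI.uniform hc)) (uniform_comb hc hF (hJ.uniform hc))
      (pos_comb_info hc hse hE hF hEF hI hJ),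
    hEnt.1 _ _ hE (hI.uniform hc), hEnt.1 _ _ hF (hJ.uniform hc), hEnt.2.2.2 I hI,
    hEnt.2.2.2 J hJ, ← hpow hIpos, ← hpow hJpos, Real.rpow_le_rpow_left_iff one_lt_two]

end Entropy

end EidoSys

/-- If `a * N` and `b * N` bounded by natural numbers from either side force the same bound
on `c * N`, for every positive natural `N`, then `c = a + b`. -/
theorem eq_add_of_forall_nat_bounds {a b c : ℝ} (ha : 0 < a) (hb : 0 < b)
    (hle : ∀ N k l : ℕ, 0 < N → 0 < k → 0 < l → (k : ℝ) ≤ a * N → (l : ℝ) ≤ b * N →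
      (k : ℝ) + l ≤ c * N)
    (hge : ∀ N k l : ℕ, 0 < N → 0 < k → 0 < l → a * N ≤ k → b * N ≤ l →
      c * N ≤ (k : ℝ) + l) : c = a + b := by
  refine le_antisymm (le_of_forall_pos_le_add fun ε hε => ?_)
    (le_of_forall_pos_le_add fun ε hε => ?_)
  · obtain ⟨N, hN⟩ := exists_nat_gt (2 / ε)
    have hNpos : (0 : ℝ) < N := lt_trans (by positivity) hN
    rw [div_lt_iff₀ hε] at hN
    have h := hge N ⌈a * N⌉₊ ⌈b * N⌉₊ (Nat.cast_pos.1 hNpos) (Nat.ceil_pos.2 (by positivity))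
      (Nat.ceil_pos.2 (by positivity)) (Nat.le_ceil _) (Nat.le_ceil _)
    have hk := Nat.ceil_lt_add_one (a := a * N) (by positivity)
    have hl := Nat.ceil_lt_add_one (a := b * N) (by positivity)
    refine le_of_mul_le_mul_right ?_ hNpos
    nlinarith
  · obtain ⟨N, hN⟩ := exists_nat_gt (max (2 / ε) (max (1 / a) (1 / b)))
    obtain ⟨hNε, hN'⟩ := max_lt_iff.1 hN
    obtain ⟨hNa, hNb⟩ := max_lt_iff.1 hN'
    have hNpos : (0 : ℝ) < N := lt_trans (by positivity) hNε
    rw [div_lt_iff₀ hε] at hNε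
    rw [div_lt_iff₀' ha] at hNa
    rw [div_lt_iff₀' hb] at hNb
    have h := hle N ⌊a * N⌋₊ ⌊b * N⌋₊ (Nat.cast_pos.1 hNpos) (Nat.floor_pos.2 hNa.le)
      (Nat.floor_pos.2 hNb.le) (Nat.floor_le (by positivity)) (Nat.floor_le (by positivity))
    have hk := Nat.lt_floor_add_one (a * N)
    have hl := Nat.lt_floor_add_one (b * N)
    refine le_of_mul_le_mul_right ?_ hNpos
    nlinarith

/-- If the uniform eidostate E is the disjoint union of uniform eidostates
E₁ and E₂, then 𝕊(E) = log₂(2^𝕊(E₁) + 2^𝕊(E₂)). -/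
theorem stmt13 (S : EidoSys) (hinfo : S.InfoAxiom) (hdemon : S.DemonAxiom)
    (hstab : S.StabilityAxiom) (hse : S.StateEquivAxiom)
    (M : Set S.State) (hM : S.MechSet M)
    (Ent : Finset S.State → ℝ) (hEnt : S.IsEntropyU M Ent)
    (hcomp : ∀ E F : Finset S.State, S.Uniform E → S.Uniform F →
      (∀ Q : Finset S.State → ℝ, S.IsCoCU Q → Q E = Q F) → S.Pos E F)
    (E E₁ E₂ : Finset S.State) (hE : S.Uniform E) (hE₁ : S.Uniform E₁) (hE₂ : S.Uniform E₂)
    (hdisj : Disjoint E₁ E₂) (hunion : E = E₁ ∪ E₂) :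
    Ent E = Real.logb 2 ((2 : ℝ) ^ (Ent E₁) + (2 : ℝ) ^ (Ent E₂)) := by
  have hc : S.ContentComplete := hcomp
  obtain ⟨e, he₁⟩ := S.eido_nonempty E₁ hE₁.1
  obtain ⟨e', he₂⟩ := S.eido_nonempty E₂ hE₂.1
  have he : e ∈ E := hunion ▸ Finset.mem_union_left _ he₁
  have he' : e' ∈ E := hunion ▸ Finset.mem_union_right _ he₂
  have hue := EidoSys.uniform_singleton e
  have hc₀ : S.SameContent E {e} := EidoSys.sameContent_singleton hc hse hE he
  have hc₁ : S.SameContent E₁ {e} := EidoSys.sameContent_singleton hc hse hE₁ he₁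
  have hc₂ : S.SameContent E₂ {e} := fun Q hQ =>
    ((EidoSys.sameContent_singleton hc hse hE₂ he₂ Q hQ).trans
      (EidoSys.sameContent_singleton hc hse hE he' Q hQ).symm).trans (hc₀ Q hQ)
  -- information states splitting as disjoint unions of prescribed sizes
  have hsplit : ∀ k l : ℕ, 0 < k → 0 < l → ∃ K L : Finset S.State, S.IsInfo K ∧ S.IsInfo L ∧
      S.IsInfo (K ∪ L) ∧ Disjoint K L ∧ K.card = k ∧ L.card = l := by
    intro k l hk hl
    obtain ⟨J, hJ, hJcard⟩ := EidoSys.exists_isInfo_card_eq hinfo (Nat.add_pos_left hk l)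
    obtain ⟨K, hKJ, hK⟩ := Finset.exists_subset_card_eq (show k ≤ J.card by omega)
    have hL : (J \ K).card = l := by rw [Finset.card_sdiff_of_subset hKJ]; omega
    exact ⟨K, J \ K, hJ.subset hKJ (Finset.card_pos.1 (by omega)),
      hJ.subset Finset.sdiff_subset (Finset.card_pos.1 (by omega)),
      by rwa [Finset.union_sdiff_of_subset hKJ], Finset.disjoint_sdiff, hK, hL⟩
  have hepos : (0 : ℝ) < 2 ^ Ent {e} := by positivity
  have key : (2 : ℝ) ^ Ent E / 2 ^ Ent {e} =
      2 ^ Ent E₁ / 2 ^ Ent {e} + 2 ^ Ent E₂ / 2 ^ Ent {e} := by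
    refine eq_add_of_forall_nat_bounds (by positivity) (by positivity) ?_ ?_ <;>
    intro N k l hN hk hl h₁ h₂ <;>
    obtain ⟨I, hI, rfl⟩ := EidoSys.exists_isInfo_card_eq hinfo hN <;>
    obtain ⟨K, L, hK, hL, hKL, hd, rfl, rfl⟩ := hsplit k l hk hl <;>
    have huE := EidoSys.uniform_comb hc hE (hI.uniform hc) <;>
    have hue' := EidoSys.uniform_comb hc hue (hKL.uniform hc) <;>
    have hdE := EidoSys.disjoint_comb_left hdisj I I <;>
    have hde := EidoSys.disjoint_comb_right hd {e} {e} <;>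
    have memE₁ := (EidoSys.uniform_comb hc hE₁ (hI.uniform hc)).1 <;>
    have memE₂ := (EidoSys.uniform_comb hc hE₂ (hI.uniform hc)).1 <;>
    have memK := (EidoSys.uniform_comb hc hue (hK.uniform hc)).1 <;>
    have memL := (EidoSys.uniform_comb hc hue (hL.uniform hc)).1
    · rw [div_mul_eq_mul_div, le_div_iff₀' hepos] at h₁ h₂ ⊢
      have a₁ := (EidoSys.arrow_comb_info_iff hc hse hEnt hue hE₁
        (fun Q hQ => (hc₁ Q hQ).symm) hK hI).2 h₁
      have a₂ := (EidoSys.arrow_comb_info_iff hc hse hEnt hue hE₂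
        (fun Q hQ => (hc₂ Q hQ).symm) hL hI).2 h₂
      rw [← Nat.cast_add, ← Finset.card_union_of_disjoint hd]
      refine (EidoSys.arrow_comb_info_iff hc hse hEnt hue hE
        (fun Q hQ => (hc₀ Q hQ).symm) hKL hI).1 ?_
      rw [hunion, EidoSys.comb_union_left] at huE ⊢
      rw [EidoSys.comb_union_right] at hue' ⊢
      exact S.arrow_union _ _ _ _ memK memL memE₁ memE₂ hde hdE hue'.2 huE.2 a₁ a₂
    · rw [div_mul_eq_mul_div, div_le_iff₀' hepos] at h₁ h₂ ⊢
      have a₁ := (EidoSys.arrow_comb_info_iff hc hse hEnt hE₁ hue hc₁ hI hK).2 h₁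
      have a₂ := (EidoSys.arrow_comb_info_iff hc hse hEnt hE₂ hue hc₂ hI hL).2 h₂
      rw [← Nat.cast_add, ← Finset.card_union_of_disjoint hd]
      refine (EidoSys.arrow_comb_info_iff hc hse hEnt hE hue hc₀ hI hKL).1 ?_
      rw [hunion, EidoSys.comb_union_left] at huE ⊢
      rw [EidoSys.comb_union_right] at hue' ⊢
      exact S.arrow_union _ _ _ _ memE₁ memE₂ memK memL hdE hde huE.2 hue'.2 a₁ a₂
  rw [← add_div, div_left_inj' hepos.ne'] at key
  rw [← key, Real.logb_rpow two_pos (by norm_num)]
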